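/- Let d,T ∈ ℕ, B ≥ 0, α ∈ (0,1), and define for a probability measure μ on ℝ^{dT} with finite first moment the risk-minimization value ℛ_α^B(μ) = inf_{H ∈ ℋ_B} ES_α(Σ_{t=1}^{T−1} H_t(X_{1:t})·(X_{t+1} − X_t)) with X ∼ μ, where ℋ_B = {H ∈ 𝒦 : ‖H‖_∞ ≤ B}. Then for all such μ, ν: ℛ_α^B(μ) − ℛ_α^B(ν) ≤ (2B/α)·CW₁(μ,ν) and |ℛ_α^B(μ) − ℛ_α^B(ν)| ≤ (2B/α)·AW₁(μ,ν). -/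

import Mathlib

open MeasureTheory ProbabilityTheory ENNReal

noncomputable section

/-- The path space `ℝ^{dT}`: paths of length `T` with values in `ℝ^d`. -/
abbrev TPath (d T : ℕ) := Fin T → Fin d → ℝ

/-- Euclidean norm on `ℝ^d`. -/
def eNorm {d : ℕ} (v : Fin d → ℝ) : ℝ := Real.sqrt (∑ i, (v i) ^ 2)

/-- The norm `‖x‖ = ∑_{t=1}^T ‖x_t‖_{ℝ^d}` on the path space. -/
def pathNorm {d T : ℕ} (x : TPath d T) : ℝ := ∑ t, eNorm (x t)

/-- The truncated history `x_{1:t}` of a path, encoded by zeroing out coordinates after time `t`. -/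
def hist {d T : ℕ} (t : ℕ) (x : TPath d T) : TPath d T :=
  fun s => if (s : ℕ) < t then x s else 0

/-- `π` is a coupling of `μ` and `ν`. -/
def IsCoupling {d₁ d₂ T : ℕ} (μ : Measure (TPath d₁ T)) (ν : Measure (TPath d₂ T))
    (π : Measure (TPath d₁ T × TPath d₂ T)) : Prop :=
  π.map Prod.fst = μ ∧ π.map Prod.snd = ν

/-- A coupling `π` is causal: for every `t`, the conditional law of `y_{1:t}` given the full
path `x` depends only on `x_{1:t}`, expressed via conditional expectations of bounded
measurable functions of `y_{1:t}`. -/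
def IsCausalCoupling {d₁ d₂ T : ℕ} (π : Measure (TPath d₁ T × TPath d₂ T)) : Prop :=
  ∀ t : ℕ, t < T → ∀ f : TPath d₂ T → ℝ, Measurable f → (∀ y, f (hist t y) = f y) →
    (∃ C, ∀ y, |f y| ≤ C) →
    π[(fun p => f p.2) | MeasurableSpace.comap Prod.fst inferInstance]
      =ᵐ[π] π[(fun p => f p.2) | MeasurableSpace.comap (fun p => hist t p.1) inferInstance]

/-- A coupling is bicausal if both it and its coordinate swap are causal. -/
def IsBicausalCoupling {d T : ℕ} (π : Measure (TPath d T × TPath d T)) : Prop :=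
  IsCausalCoupling π ∧ IsCausalCoupling (π.map Prod.swap)

/-- Causal (first order) Wasserstein distance `CW₁`. -/
def CW1 {d T : ℕ} (μ ν : Measure (TPath d T)) : ℝ :=
  sInf { r | ∃ π : Measure (TPath d T × TPath d T), IsCoupling μ ν π ∧ IsCausalCoupling π ∧
    r = ∫ p, pathNorm (p.1 - p.2) ∂π }

/-- Adapted (first order) Wasserstein distance `AW₁`. -/
def AW1 {d T : ℕ} (μ ν : Measure (TPath d T)) : ℝ :=
  sInf { r | ∃ π : Measure (TPath d T × TPath d T), IsCoupling μ ν π ∧ IsBicausalCoupling π ∧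
    r = ∫ p, pathNorm (p.1 - p.2) ∂π }

/-- Total variation `TV₀`. -/
def TV0 {d T : ℕ} (μ ν : Measure (TPath d T)) : ℝ :=
  sInf { r | ∃ π : Measure (TPath d T × TPath d T), IsCoupling μ ν π ∧
    r = (π {p | p.1 ≠ p.2}).toReal }

/-- Adapted total variation `AV₀`. -/
def AV0 {d T : ℕ} (μ ν : Measure (TPath d T)) : ℝ :=
  sInf { r | ∃ π : Measure (TPath d T × TPath d T), IsCoupling μ ν π ∧ IsBicausalCoupling π ∧
    r = (π {p | p.1 ≠ p.2}).toReal }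

open Classical in
/-- Kullback–Leibler divergence, valued in `ℝ≥0∞`. -/
def KLDiv {E : Type*} [MeasurableSpace E] (μ ν : Measure E) : ℝ≥0∞ :=
  if μ ≪ ν ∧ Integrable (llr μ ν) μ then ENNReal.ofReal (∫ x, llr μ ν x ∂μ) else ⊤

/-- A map between path spaces is causal if its `t`-th coordinate depends only on `x_{1:t}`,
with Borel-measurability. -/
def IsCausalMap {d₁ d₂ T : ℕ} (𝒯 : TPath d₁ T → TPath d₂ T) : Prop :=
  Measurable 𝒯 ∧
    ∀ (t : Fin T) (x x' : TPath d₁ T), (∀ s : Fin T, s ≤ t → x s = x' s) → 𝒯 x t = 𝒯 x' t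

/-- Standard Gaussian measure `N(0, I_{d_Z T})`. -/
def stdGaussian (dZ T : ℕ) : Measure (TPath dZ T) :=
  Measure.pi fun _ : Fin T => Measure.pi fun _ : Fin dZ => gaussianReal 0 1

/-- Expected shortfall `ES_α(U) = inf_z { α⁻¹ E[(z − U)₊] − z }`. -/
def ES {Ω : Type*} [MeasurableSpace Ω] (α : ℝ) (ρ : Measure Ω) (U : Ω → ℝ) : ℝ :=
  sInf { r | ∃ z : ℝ, r = α⁻¹ * (∫ ω, max (z - U ω) 0 ∂ρ) - z }

/-- Profit and loss `Q(x,h) = ∑_{t=1}^{T−1} h_t · (x_{t+1} − x_t)`. -/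
def pnl {d T : ℕ} (x h : TPath d T) : ℝ :=
  ∑ t : Fin (T - 1), ∑ i,
    h ⟨t, by have := t.isLt; omega⟩ i *
      (x ⟨t + 1, by have := t.isLt; omega⟩ i - x ⟨t, by have := t.isLt; omega⟩ i)

/-- `ℛ_α^B(μ) = inf_{H ∈ ℋ_B} ES_α(∑_t H_t(X_{1:t})·(X_{t+1} − X_t))`, `X ∼ μ`. -/
def RiskValB {d T : ℕ} (α B : ℝ) (μ : Measure (TPath d T)) : ℝ :=
  sInf { r | ∃ H : TPath d T → TPath d T, IsCausalMap H ∧ (∀ x t, eNorm (H x t) ≤ B) ∧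
    r = ES α μ (fun x => pnl x (H x)) }

section PathSpace

variable {d T : ℕ}

lemma eNorm_eq_norm (v : Fin d → ℝ) : eNorm v = ‖WithLp.toLp 2 v‖ := by
  simp [eNorm, EuclideanSpace.norm_eq]

lemma eNorm_nonneg (v : Fin d → ℝ) : 0 ≤ eNorm v := Real.sqrt_nonneg _

lemma eNorm_sub_le (v w : Fin d → ℝ) : eNorm (v - w) ≤ eNorm v + eNorm w := by
  simp only [eNorm_eq_norm, WithLp.toLp_sub]
  exact norm_sub_le _ _

lemma eNorm_sub_comm (v w : Fin d → ℝ) : eNorm (v - w) = eNorm (w - v) := by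
  simp only [eNorm_eq_norm, WithLp.toLp_sub]
  exact norm_sub_rev _ _

lemma sum_mul_le_eNorm_mul_eNorm (v w : Fin d → ℝ) :
    ∑ i, v i * w i ≤ eNorm v * eNorm w :=
  Real.sum_mul_le_sqrt_mul_sqrt _ v w

lemma abs_sum_mul_le_eNorm_mul_eNorm (v w : Fin d → ℝ) :
    |∑ i, v i * w i| ≤ eNorm v * eNorm w := by
  refine abs_le'.2 ⟨sum_mul_le_eNorm_mul_eNorm v w, ?_⟩
  have h := sum_mul_le_eNorm_mul_eNorm (-v) w
  have h' : eNorm (-v) = eNorm v := by simp [eNorm]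
  rw [h'] at h
  simpa using h

lemma abs_apply_le_eNorm (v : Fin d → ℝ) (i : Fin d) : |v i| ≤ eNorm v :=
  Real.abs_le_sqrt
    (Finset.single_le_sum (f := fun j => v j ^ 2) (fun _ _ => sq_nonneg _) (Finset.mem_univ i))

lemma measurable_eNorm : Measurable (eNorm : (Fin d → ℝ) → ℝ) := by
  unfold eNorm
  fun_prop

lemma measurable_pathNorm : Measurable (pathNorm : TPath d T → ℝ) :=
  Finset.measurable_sum _ fun t _ => measurable_eNorm.comp (measurable_pi_apply t)

lemma pathNorm_nonneg (x : TPath d T) : 0 ≤ pathNorm x :=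
  Finset.sum_nonneg fun _ _ => eNorm_nonneg _

lemma eNorm_apply_le_pathNorm (x : TPath d T) (t : Fin T) : eNorm (x t) ≤ pathNorm x :=
  Finset.single_le_sum (f := fun s => eNorm (x s)) (fun _ _ => eNorm_nonneg _) (Finset.mem_univ t)

lemma pathNorm_sub_le (x y : TPath d T) : pathNorm (x - y) ≤ pathNorm x + pathNorm y := by
  unfold pathNorm
  rw [← Finset.sum_add_distrib]
  exact Finset.sum_le_sum fun t _ => eNorm_sub_le (x t) (y t)

lemma pathNorm_sub_comm (x y : TPath d T) : pathNorm (x - y) = pathNorm (y - x) :=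
  Finset.sum_congr rfl fun t _ => eNorm_sub_comm (x t) (y t)

lemma measurable_hist (t : ℕ) : Measurable (hist t : TPath d T → TPath d T) := by
  refine measurable_pi_lambda _ fun s => ?_
  by_cases h : (s : ℕ) < t
  · simpa [hist, h] using measurable_pi_apply s
  · simp [hist, h]

lemma pnl_sub_left (x y h : TPath d T) : pnl (x - y) h = pnl x h - pnl y h := by
  simp only [pnl, ← Finset.sum_sub_distrib, Pi.sub_apply]
  exact Finset.sum_congr rfl fun _ _ => Finset.sum_congr rfl fun _ _ => by ring

lemma abs_pnl_le {B : ℝ} (hB : 0 ≤ B) (x h : TPath d T) (hh : ∀ t, eNorm (h t) ≤ B) :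
    |pnl x h| ≤ 2 * B * pathNorm x := by
  cases T with
  | zero => simp [pnl, pathNorm]
  | succ n =>
    have hsucc : ∑ t : Fin n, eNorm (x t.succ) ≤ pathNorm x := by
      unfold pathNorm
      rw [Fin.sum_univ_succ]
      linarith [eNorm_nonneg (x 0)]
    have hcast : ∑ t : Fin n, eNorm (x t.castSucc) ≤ pathNorm x := by
      unfold pathNorm
      rw [Fin.sum_univ_castSucc]
      linarith [eNorm_nonneg (x (Fin.last n))]
    have hterm (t : Fin n) : |∑ i, h t.castSucc i * (x t.succ i - x t.castSucc i)| ≤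
        B * (eNorm (x t.succ) + eNorm (x t.castSucc)) :=
      (abs_sum_mul_le_eNorm_mul_eNorm (h t.castSucc) (x t.succ - x t.castSucc)).trans
        (mul_le_mul (hh _) (eNorm_sub_le _ _) (eNorm_nonneg _) hB)
    calc |pnl x h|
        ≤ ∑ t : Fin n, |∑ i, h t.castSucc i * (x t.succ i - x t.castSucc i)| :=
          Finset.abs_sum_le_sum_abs _ _
      _ ≤ ∑ t : Fin n, B * (eNorm (x t.succ) + eNorm (x t.castSucc)) :=
          Finset.sum_le_sum fun t _ => hterm t
      _ = B * (∑ t : Fin n, eNorm (x t.succ) + ∑ t : Fin n, eNorm (x t.castSucc)) := by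
          rw [← Finset.mul_sum, Finset.sum_add_distrib]
      _ ≤ B * (pathNorm x + pathNorm x) := by gcongr
      _ = 2 * B * pathNorm x := by ring

variable {Ω : Type*} [MeasurableSpace Ω]

lemma measurable_pnl {X h : Ω → TPath d T} (hX : Measurable X) (hh : Measurable h) :
    Measurable fun ω => pnl (X ω) (h ω) := by
  unfold pnl
  fun_prop

lemma integrable_pnl {ρ : Measure Ω} {B : ℝ} (hB : 0 ≤ B) {X h : Ω → TPath d T}
    (hX : Measurable X) (hh : Measurable h) (hint : Integrable (fun ω => pathNorm (X ω)) ρ)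
    (hbd : ∀ ω t, eNorm (h ω t) ≤ B) : Integrable (fun ω => pnl (X ω) (h ω)) ρ :=
  (hint.const_mul (2 * B)).mono' (measurable_pnl hX hh).aestronglyMeasurable
    (Filter.Eventually.of_forall fun ω => abs_pnl_le hB _ _ (hbd ω))

lemma integrable_apply_of_pathNorm {ρ : Measure Ω} {X : Ω → TPath d T} (hX : Measurable X)
    (hint : Integrable (fun ω => pathNorm (X ω)) ρ) (t : Fin T) (i : Fin d) :
    Integrable (fun ω => X ω t i) ρ :=
  hint.mono' (by fun_prop) (Filter.Eventually.of_forall fun ω =>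
    (abs_apply_le_eNorm _ i).trans (eNorm_apply_le_pathNorm _ t))

end PathSpace

section ExpectedShortfall

variable {Ω : Type*} [MeasurableSpace Ω]

lemma integrable_shortfall {ρ : Measure Ω} [IsProbabilityMeasure ρ] {U : Ω → ℝ}
    (hU : Integrable U ρ) (z : ℝ) : Integrable (fun ω => max (z - U ω) 0) ρ :=
  ((integrable_const z).sub hU).pos_part

lemma neg_integral_le_shortfall {α : ℝ} (hα : α ∈ Set.Ioo (0 : ℝ) 1) {ρ : Measure Ω}
    [IsProbabilityMeasure ρ] {U : Ω → ℝ} (hU : Integrable U ρ) (z : ℝ) :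
    -∫ ω, U ω ∂ρ ≤ α⁻¹ * (∫ ω, max (z - U ω) 0 ∂ρ) - z := by
  have h0 : 0 ≤ ∫ ω, max (z - U ω) 0 ∂ρ := integral_nonneg fun _ => le_max_right _ _
  have h1 : z - ∫ ω, U ω ∂ρ ≤ ∫ ω, max (z - U ω) 0 ∂ρ := by
    have h := integral_mono ((integrable_const z).sub hU) (integrable_shortfall hU z)
      fun ω => le_max_left (z - U ω) 0
    simpa [integral_sub (integrable_const z) hU] using h
  have h2 : 1 ≤ α⁻¹ := (one_le_inv₀ hα.1).2 hα.2.le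
  nlinarith

lemma ES_le {α : ℝ} (hα : α ∈ Set.Ioo (0 : ℝ) 1) {ρ : Measure Ω}
    [IsProbabilityMeasure ρ] {U : Ω → ℝ} (hU : Integrable U ρ) (z : ℝ) :
    ES α ρ U ≤ α⁻¹ * (∫ ω, max (z - U ω) 0 ∂ρ) - z :=
  csInf_le ⟨-∫ ω, U ω ∂ρ, by rintro _ ⟨z, rfl⟩; exact neg_integral_le_shortfall hα hU z⟩ ⟨z, rfl⟩

lemma neg_integral_le_ES {α : ℝ} (hα : α ∈ Set.Ioo (0 : ℝ) 1) {ρ : Measure Ω}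
    [IsProbabilityMeasure ρ] {U : Ω → ℝ} (hU : Integrable U ρ) :
    -∫ ω, U ω ∂ρ ≤ ES α ρ U :=
  le_csInf ⟨_, 0, rfl⟩ (by rintro _ ⟨z, rfl⟩; exact neg_integral_le_shortfall hα hU z)

variable {d T : ℕ}

lemma RiskValB_le {B α : ℝ} (hB : 0 ≤ B) (hα : α ∈ Set.Ioo (0 : ℝ) 1)
    {μ : Measure (TPath d T)} [IsProbabilityMeasure μ]
    (hμ : Integrable (fun x => pathNorm x) μ) {H : TPath d T → TPath d T} (hH : IsCausalMap H)
    (hbd : ∀ x t, eNorm (H x t) ≤ B) :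
    RiskValB α B μ ≤ ES α μ (fun x => pnl x (H x)) := by
  refine csInf_le ⟨-∫ x, 2 * B * pathNorm x ∂μ, ?_⟩ ⟨H, hH, hbd, rfl⟩
  rintro _ ⟨K, hK, hKbd, rfl⟩
  have hint := integrable_pnl hB measurable_id hK.1 hμ hKbd
  refine le_trans (neg_le_neg ?_) (neg_integral_le_ES hα hint)
  exact integral_mono hint (hμ.const_mul _) fun x => (le_abs_self _).trans
    (abs_pnl_le hB _ _ (hKbd x))

end ExpectedShortfall

section Projection

variable {d T : ℕ}

/-- The projection of a strategy along a coupling: the position at time `t` is the conditional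
expectation of `H_t(y)` given the history `x_{1:t}`. -/
def causalProj (π : Measure (TPath d T × TPath d T)) [IsFiniteMeasure π]
    (H : TPath d T → TPath d T) : TPath d T → TPath d T :=
  fun x t i => ∫ y, H y t i ∂condDistrib Prod.snd
    (fun p : TPath d T × TPath d T => hist (t + 1) p.1) π (hist (t + 1) x)

variable {π : Measure (TPath d T × TPath d T)} [IsProbabilityMeasure π]
  {H : TPath d T → TPath d T} {B : ℝ}

lemma isCausalMap_causalProj (hH : Measurable H) : IsCausalMap (causalProj π H) := by
  refine ⟨?_, fun t x x' hx => ?_⟩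
  · refine measurable_pi_lambda _ fun t => measurable_pi_lambda _ fun i => ?_
    have h : StronglyMeasurable fun y => H y t i := Measurable.stronglyMeasurable (by fun_prop)
    exact (h.integral_kernel (κ := condDistrib Prod.snd
      (fun p : TPath d T × TPath d T => hist (t + 1) p.1) π)).measurable.comp (measurable_hist _)
  · have h : hist (t + 1) x = hist (t + 1) x' := by
      funext s
      by_cases hs : (s : ℕ) < t + 1
      · simpa [hist, hs] using hx s (Fin.le_def.2 (Nat.lt_succ_iff.1 hs))
      · simp [hist, hs]
    funext i
    simp only [causalProj, h]

lemma integrable_apply_of_eNorm_le {ρ : Measure (TPath d T)} [IsProbabilityMeasure ρ]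
    (hH : Measurable H) (hbd : ∀ x t, eNorm (H x t) ≤ B) (t : Fin T) (i : Fin d) :
    Integrable (fun y => H y t i) ρ :=
  Integrable.of_bound (by fun_prop) B
    (Filter.Eventually.of_forall fun y => (abs_apply_le_eNorm _ i).trans (hbd y t))

lemma eNorm_integral_le {ρ : Measure (TPath d T)} [IsProbabilityMeasure ρ]
    (hH : Measurable H) (hbd : ∀ x t, eNorm (H x t) ≤ B) (t : Fin T) :
    eNorm (fun i => ∫ y, H y t i ∂ρ) ≤ B := by
  set g : Fin d → ℝ := fun i => ∫ y, H y t i ∂ρ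
  have hint (i : Fin d) := (integrable_apply_of_eNorm_le (ρ := ρ) hH hbd t i).const_mul (g i)
  have hsq : eNorm g ^ 2 ≤ eNorm g * B := by
    calc eNorm g ^ 2 = ∑ i, g i * g i := by
          rw [eNorm, Real.sq_sqrt (Finset.sum_nonneg fun _ _ => sq_nonneg _)]
          exact Finset.sum_congr rfl fun _ _ => sq _
      _ = ∫ y, ∑ i, g i * H y t i ∂ρ := by
          rw [integral_finsetSum _ fun i _ => hint i]
          exact Finset.sum_congr rfl fun i _ => (integral_const_mul _ _).symm
      _ ≤ ∫ _, eNorm g * B ∂ρ :=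
          integral_mono (integrable_finsetSum _ fun i _ => hint i) (integrable_const _) fun y =>
            (sum_mul_le_eNorm_mul_eNorm g (H y t)).trans
              (mul_le_mul_of_nonneg_left (hbd y t) (eNorm_nonneg _))
      _ = eNorm g * B := by simp
  by_contra! hlt
  nlinarith [eNorm_nonneg g, (eNorm_nonneg _).trans (hbd 0 t)]

lemma eNorm_causalProj_le (hH : Measurable H) (hbd : ∀ x t, eNorm (H x t) ≤ B)
    (x : TPath d T) (t : Fin T) : eNorm (causalProj π H x t) ≤ B :=
  eNorm_integral_le hH hbd t

/-- Under a causal coupling, the projection of a causal strategy is its conditional expectation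
given the whole path `x`. -/
lemma condExp_ae_eq_causalProj (hπ : IsCausalCoupling π) (hH : IsCausalMap H)
    (hbd : ∀ x t, eNorm (H x t) ≤ B) (t : Fin T) (ht : (t : ℕ) + 1 < T) (i : Fin d) :
    π[(fun p => H p.2 t i) | MeasurableSpace.comap Prod.fst inferInstance]
      =ᵐ[π] fun p => causalProj π H p.1 t i := by
  have hHm := hH.1
  have hm : Measurable fun y => H y t i := by fun_prop
  refine (hπ (t + 1) ht (fun y => H y t i) hm (fun y => ?_)
    ⟨B, fun y => (abs_apply_le_eNorm _ i).trans (hbd y t)⟩).trans ?_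
  · refine congrFun (hH.2 t _ _ fun s hs => ?_) i
    simp [hist, Nat.lt_succ_iff.2 (Fin.le_def.1 hs)]
  · exact condExp_ae_eq_integral_condDistrib ((measurable_hist _).comp measurable_fst)
      measurable_snd.aemeasurable hm.stronglyMeasurable
      (Integrable.of_bound (hm.comp measurable_snd).aestronglyMeasurable B
        (Filter.Eventually.of_forall fun p => (abs_apply_le_eNorm _ i).trans (hbd p.2 t)))

lemma integral_causalProj_mul (hπ : IsCausalCoupling π) (hH : IsCausalMap H)
    (hbd : ∀ x t, eNorm (H x t) ≤ B) (t : Fin T) (ht : (t : ℕ) + 1 < T) (i : Fin d)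
    {φ : TPath d T → ℝ} (hφ : Measurable φ) (hφint : Integrable (fun p => φ p.1) π) :
    ∫ p, causalProj π H p.1 t i * φ p.1 ∂π = ∫ p, H p.2 t i * φ p.1 ∂π := by
  have hHm := hH.1
  have hae : ∀ p : TPath d T × TPath d T, ‖H p.2 t i‖ ≤ B :=
    fun p => (abs_apply_le_eNorm _ i).trans (hbd p.2 t)
  have hm : Measurable fun y => H y t i := by fun_prop
  have hmeas : AEStronglyMeasurable (fun p : TPath d T × TPath d T => H p.2 t i) π :=
    (hm.comp measurable_snd).aestronglyMeasurable
  have hHint : Integrable (fun p : TPath d T × TPath d T => H p.2 t i) π :=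
    Integrable.of_bound hmeas B (Filter.Eventually.of_forall hae)
  have hprod : Integrable (fun p : TPath d T × TPath d T => H p.2 t i * φ p.1) π :=
    hφint.bdd_mul hmeas (Filter.Eventually.of_forall hae)
  have hφm : StronglyMeasurable[MeasurableSpace.comap
      (Prod.fst : TPath d T × TPath d T → TPath d T) inferInstance]
      fun p : TPath d T × TPath d T => φ p.1 :=
    (hφ.comp (comap_measurable _)).stronglyMeasurable
  have hpull := condExp_mul_of_stronglyMeasurable_right hφm hprod hHint
  rw [← integral_condExp (μ := π) (f := fun p => H p.2 t i * φ p.1) measurable_fst.comap_le]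
  refine integral_congr_ae ?_
  filter_upwards [hpull, condExp_ae_eq_causalProj hπ hH hbd t ht i] with p h1 h2
  refine Eq.trans ?_ h1.symm
  simp only [Pi.mul_apply, h2]

lemma mul_pnl (c : ℝ) (x h : TPath d T) :
    c * pnl x h = ∑ t : Fin (T - 1), ∑ i, h ⟨t, by have := t.isLt; omega⟩ i *
      (c * (x ⟨t + 1, by have := t.isLt; omega⟩ i - x ⟨t, by have := t.isLt; omega⟩ i)) := by
  simp only [pnl, Finset.mul_sum]
  exact Finset.sum_congr rfl fun _ _ => Finset.sum_congr rfl fun _ _ => by ring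

lemma integral_indicator_mul_pnl_causalProj (hπ : IsCausalCoupling π) (hH : IsCausalMap H)
    (hbd : ∀ x t, eNorm (H x t) ≤ B) (hint : Integrable (fun p => pathNorm p.1) π)
    {A : Set (TPath d T)} (hA : MeasurableSet A) :
    ∫ p, A.indicator 1 p.1 * pnl p.1 (causalProj π H p.1) ∂π =
      ∫ p, A.indicator 1 p.1 * pnl p.1 (H p.2) ∂π := by
  have hHm := hH.1
  have hGm := (isCausalMap_causalProj (π := π) hHm).1
  have hAm : Measurable (A.indicator (1 : TPath d T → ℝ)) := measurable_one.indicator hA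
  have hA1 (x : TPath d T) : ‖A.indicator (1 : TPath d T → ℝ) x‖ ≤ 1 := by
    by_cases hx : x ∈ A <;> simp [hx]
  have hφ (s t : Fin T) (i : Fin d) :
      Integrable (fun p : TPath d T × TPath d T => A.indicator 1 p.1 * (p.1 s i - p.1 t i)) π :=
    ((integrable_apply_of_pathNorm measurable_fst hint s i).sub
      (integrable_apply_of_pathNorm measurable_fst hint t i)).bdd_mul (c := 1)
      (hAm.comp measurable_fst).aestronglyMeasurable
      (Filter.Eventually.of_forall fun p => hA1 p.1)
  have hterm {K : TPath d T × TPath d T → TPath d T} (hK : Measurable K)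
      (hKbd : ∀ p t, eNorm (K p t) ≤ B) (r s t : Fin T) (i : Fin d) :
      Integrable (fun p => K p r i * (A.indicator 1 p.1 * (p.1 s i - p.1 t i))) π :=
    (hφ s t i).bdd_mul (by fun_prop)
      (Filter.Eventually.of_forall fun p => (abs_apply_le_eNorm _ i).trans (hKbd p r))
  have hG (r s t : Fin T) (i : Fin d) := hterm (hGm.comp measurable_fst)
    (fun p => eNorm_causalProj_le hHm hbd p.1) r s t i
  have hY (r s t : Fin T) (i : Fin d) := hterm (hHm.comp measurable_snd)
    (fun p => hbd p.2) r s t i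
  simp only [Function.comp_apply] at hG hY
  simp only [mul_pnl]
  rw [integral_finsetSum _ fun t _ => integrable_finsetSum _ fun i _ => hG _ _ _ i,
    integral_finsetSum _ fun t _ => integrable_finsetSum _ fun i _ => hY _ _ _ i]
  refine Finset.sum_congr rfl fun t _ => ?_
  rw [integral_finsetSum _ fun i _ => hG _ _ _ i, integral_finsetSum _ fun i _ => hY _ _ _ i]
  refine Finset.sum_congr rfl fun i _ => ?_
  exact integral_causalProj_mul hπ hH hbd _ (by have := t.isLt; simp only; omega) i
    (φ := fun x => A.indicator 1 x * (x _ i - x _ i)) (by fun_prop) (hφ _ _ i)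

/-- Jensen's inequality for the shortfall of a strategy projected along a causal coupling. -/
lemma integral_shortfall_causalProj_le (hB : 0 ≤ B) (hπ : IsCausalCoupling π)
    (hH : IsCausalMap H) (hbd : ∀ x t, eNorm (H x t) ≤ B)
    (hint : Integrable (fun p => pathNorm p.1) π) (z : ℝ) :
    ∫ p, max (z - pnl p.1 (causalProj π H p.1)) 0 ∂π ≤ ∫ p, max (z - pnl p.1 (H p.2)) 0 ∂π := by
  have hHm := hH.1
  have hGm := (isCausalMap_causalProj (π := π) hHm).1
  have hGint : Integrable (fun p => pnl p.1 (causalProj π H p.1)) π :=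
    integrable_pnl hB measurable_fst (hGm.comp measurable_fst) hint
      fun p => eNorm_causalProj_le hHm hbd p.1
  have hYint : Integrable (fun p => pnl p.1 (H p.2)) π :=
    integrable_pnl hB measurable_fst (hHm.comp measurable_snd) hint fun p => hbd p.2
  set A : Set (TPath d T) := {x | pnl x (causalProj π H x) < z}
  have hA : MeasurableSet A :=
    measurableSet_lt (measurable_pnl measurable_id hGm) measurable_const
  have hAm : AEStronglyMeasurable
      (fun p : TPath d T × TPath d T => A.indicator (1 : TPath d T → ℝ) p.1) π :=
    ((measurable_one.indicator hA).comp measurable_fst).aestronglyMeasurable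
  have hA1 : ∀ᵐ p ∂π, ‖A.indicator (1 : TPath d T → ℝ) p.1‖ ≤ 1 :=
    Filter.Eventually.of_forall fun p => by by_cases hp : p.1 ∈ A <;> simp [hp]
  have hAint : Integrable (fun p => A.indicator (1 : TPath d T → ℝ) p.1 * z) π :=
    (integrable_const z).bdd_mul hAm hA1
  have hAG := hGint.bdd_mul hAm hA1
  have hAY := hYint.bdd_mul hAm hA1
  calc ∫ p, max (z - pnl p.1 (causalProj π H p.1)) 0 ∂π
      = ∫ p, (A.indicator 1 p.1 * z - A.indicator 1 p.1 * pnl p.1 (causalProj π H p.1)) ∂π := by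
        refine integral_congr_ae (Filter.Eventually.of_forall fun p => ?_)
        by_cases hp : p.1 ∈ A
        · have hp' : pnl p.1 (causalProj π H p.1) < z := hp
          simp [hp, hp'.le]
        · have hp' : z ≤ pnl p.1 (causalProj π H p.1) := not_lt.1 hp
          simp [hp, hp']
    _ = ∫ p, (A.indicator 1 p.1 * z - A.indicator 1 p.1 * pnl p.1 (H p.2)) ∂π := by
        rw [integral_sub hAint hAG, integral_sub hAint hAY,
          integral_indicator_mul_pnl_causalProj hπ hH hbd hint hA]
    _ ≤ ∫ p, max (z - pnl p.1 (H p.2)) 0 ∂π := by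
        refine integral_mono (hAint.sub hAY) (integrable_shortfall hYint z) fun p => ?_
        by_cases hp : p.1 ∈ A <;> simp [hp]

end Projection

section Couplings

variable {d T : ℕ} {μ ν : Measure (TPath d T)} {π : Measure (TPath d T × TPath d T)}

lemma IsCoupling.isProbabilityMeasure [IsProbabilityMeasure μ] (h : IsCoupling μ ν π) :
    IsProbabilityMeasure π := by
  refine ⟨?_⟩
  have h1 : (π.map Prod.fst) Set.univ = 1 := by rw [h.1]; exact measure_univ
  rwa [Measure.map_apply measurable_fst MeasurableSet.univ, Set.preimage_univ] at h1

lemma IsCoupling.swap (h : IsCoupling μ ν π) : IsCoupling ν μ (π.map Prod.swap) :=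
  ⟨by rw [Measure.map_map measurable_fst measurable_swap]; exact h.2,
    by rw [Measure.map_map measurable_snd measurable_swap]; exact h.1⟩

lemma integral_pathNorm_swap (π : Measure (TPath d T × TPath d T)) :
    ∫ p, pathNorm (p.1 - p.2) ∂(π.map Prod.swap) = ∫ p, pathNorm (p.1 - p.2) ∂π := by
  have hm : Measurable fun p : TPath d T × TPath d T => pathNorm (p.1 - p.2) :=
    measurable_pathNorm.comp (measurable_fst.sub measurable_snd)
  rw [integral_map measurable_swap.aemeasurable hm.aestronglyMeasurable]
  exact integral_congr_ae (Filter.Eventually.of_forall fun p => pathNorm_sub_comm _ _)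

lemma isCoupling_prod [IsProbabilityMeasure μ] [IsProbabilityMeasure ν] :
    IsCoupling μ ν (μ.prod ν) :=
  ⟨Measure.fst_prod, Measure.snd_prod⟩

lemma isCausalCoupling_prod [IsProbabilityMeasure μ] [IsProbabilityMeasure ν] :
    IsCausalCoupling (μ.prod ν) := by
  intro t _ f hf _ _
  have hfm : StronglyMeasurable[MeasurableSpace.comap
      (Prod.snd : TPath d T × TPath d T → TPath d T) inferInstance]
      fun p : TPath d T × TPath d T => f p.2 :=
    (hf.comp (comap_measurable _)).stronglyMeasurable
  have hind {g : TPath d T → TPath d T} (hg : Measurable g) :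
      (μ.prod ν)[(fun p => f p.2) | MeasurableSpace.comap (fun p => g p.1) inferInstance]
        =ᵐ[μ.prod ν] fun _ => ∫ p, f p.2 ∂(μ.prod ν) :=
    condExp_indep_eq measurable_snd.comap_le (hg.comp measurable_fst).comap_le hfm
      (indepFun_prod hg measurable_id).symm
  exact (hind measurable_id).trans (hind (measurable_hist t)).symm

lemma isBicausalCoupling_prod [IsProbabilityMeasure μ] [IsProbabilityMeasure ν] :
    IsBicausalCoupling (μ.prod ν) :=
  ⟨isCausalCoupling_prod, by rw [Measure.prod_swap]; exact isCausalCoupling_prod⟩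

/-- Stability of the risk minimization value along a causal coupling. -/
lemma RiskValB_sub_le_of_coupling {B α : ℝ} (hB : 0 ≤ B) (hα : α ∈ Set.Ioo (0 : ℝ) 1)
    [IsProbabilityMeasure μ] [IsProbabilityMeasure ν]
    (hμ : Integrable (fun x => pathNorm x) μ) (hν : Integrable (fun x => pathNorm x) ν)
    (hc : IsCoupling μ ν π) (hπ : IsCausalCoupling π) :
    RiskValB α B μ - RiskValB α B ν ≤ (2 * B / α) * ∫ p, pathNorm (p.1 - p.2) ∂π := by
  have := hc.isProbabilityMeasure
  have hfst : Integrable (fun p => pathNorm p.1) π :=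
    Integrable.comp_measurable (f := Prod.fst) (by rwa [hc.1]) measurable_fst
  have hsnd : Integrable (fun p => pathNorm p.2) π :=
    Integrable.comp_measurable (f := Prod.snd) (by rwa [hc.2]) measurable_snd
  have hdiff : Integrable (fun p => pathNorm (p.1 - p.2)) π :=
    (hfst.add hsnd).mono'
      (measurable_pathNorm.comp (measurable_fst.sub measurable_snd)).aestronglyMeasurable
      (Filter.Eventually.of_forall fun p => by
        rw [Real.norm_of_nonneg (pathNorm_nonneg _)]
        exact pathNorm_sub_le _ _)
  rw [sub_le_comm]
  refine le_csInf ⟨_, 0, ⟨measurable_const, fun _ _ _ _ => rfl⟩,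
    fun _ _ => by simpa [eNorm] using hB, rfl⟩ ?_
  rintro _ ⟨H, hH, hbd, rfl⟩
  refine le_csInf ⟨_, 0, rfl⟩ ?_
  rintro _ ⟨z, rfl⟩
  have hG := isCausalMap_causalProj (π := π) hH.1
  have hGbd := eNorm_causalProj_le (π := π) hH.1 hbd
  have hGint : Integrable (fun x => pnl x (causalProj π H x)) μ :=
    integrable_pnl hB measurable_id hG.1 hμ hGbd
  have hle := (RiskValB_le hB hα hμ hG hGbd).trans (ES_le hα hGint z)
  have hxint : Integrable (fun p => pnl p.1 (H p.2)) π :=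
    integrable_pnl hB measurable_fst (hH.1.comp measurable_snd) hfst fun p => hbd p.2
  have hyint : Integrable (fun p => pnl p.2 (H p.2)) π :=
    integrable_pnl hB measurable_snd (hH.1.comp measurable_snd) hsnd fun p => hbd p.2
  have key : ∫ x, max (z - pnl x (causalProj π H x)) 0 ∂μ ≤
      (∫ y, max (z - pnl y (H y)) 0 ∂ν) + 2 * B * ∫ p, pathNorm (p.1 - p.2) ∂π := by
    calc ∫ x, max (z - pnl x (causalProj π H x)) 0 ∂μ
        = ∫ p, max (z - pnl p.1 (causalProj π H p.1)) 0 ∂π := by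
          conv_lhs => rw [← hc.1]
          exact integral_map measurable_fst.aemeasurable
            ((measurable_const.sub (measurable_pnl measurable_id hG.1)).max
              measurable_const).aestronglyMeasurable
      _ ≤ ∫ p, max (z - pnl p.1 (H p.2)) 0 ∂π :=
          integral_shortfall_causalProj_le hB hπ hH hbd hfst z
      _ ≤ ∫ p, (max (z - pnl p.2 (H p.2)) 0 + 2 * B * pathNorm (p.1 - p.2)) ∂π := by
          refine integral_mono (integrable_shortfall hxint z)
            ((integrable_shortfall hyint z).add (hdiff.const_mul _)) fun p => ?_
          have h := abs_pnl_le hB (p.1 - p.2) (H p.2) (hbd p.2)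
          rw [pnl_sub_left] at h
          have h1 := (abs_le.1 h).1
          have h2 := (abs_nonneg _).trans h
          refine max_le ?_ (add_nonneg (le_max_right _ _) h2)
          linarith [le_max_left (z - pnl p.2 (H p.2)) 0]
      _ = (∫ y, max (z - pnl y (H y)) 0 ∂ν) + 2 * B * ∫ p, pathNorm (p.1 - p.2) ∂π := by
          rw [integral_add (integrable_shortfall hyint z) (hdiff.const_mul _),
            integral_const_mul]
          congr 1
          conv_rhs => rw [← hc.2]
          exact (integral_map measurable_snd.aemeasurable
            ((measurable_const.sub (measurable_pnl measurable_id hH.1)).max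
              measurable_const).aestronglyMeasurable).symm
  have h := mul_le_mul_of_nonneg_left key (inv_nonneg.2 hα.1.le)
  have h' : 2 * B / α * ∫ p, pathNorm (p.1 - p.2) ∂π =
      α⁻¹ * (2 * B * ∫ p, pathNorm (p.1 - p.2) ∂π) := by ring
  rw [mul_add] at h
  simp only
  linarith

lemma le_mul_csInf {S : Set ℝ} {a k : ℝ} (hk : 0 ≤ k) (hne : S.Nonempty)
    (h : ∀ r ∈ S, a ≤ k * r) : a ≤ k * sInf S := by
  rcases hk.eq_or_lt with rfl | hk
  · obtain ⟨r, hr⟩ := hne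
    simpa using h r hr
  · rw [← div_le_iff₀' hk]
    exact le_csInf hne fun r hr => (div_le_iff₀' hk).2 (h r hr)

end Couplings

/-- Robustness of risk minimization with `B`-bounded strategies w.r.t. `CW₁` and `AW₁`. -/
theorem stmt18 (d T : ℕ) (B α : ℝ) (hB : 0 ≤ B) (hα : α ∈ Set.Ioo (0 : ℝ) 1)
    (μ ν : Measure (TPath d T)) [IsProbabilityMeasure μ] [IsProbabilityMeasure ν]
    (hμ : Integrable (fun x => pathNorm x) μ) (hν : Integrable (fun x => pathNorm x) ν) :
    (RiskValB α B μ - RiskValB α B ν ≤ (2 * B / α) * CW1 μ ν) ∧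
    |RiskValB α B μ - RiskValB α B ν| ≤ (2 * B / α) * AW1 μ ν := by
  have hk : 0 ≤ 2 * B / α := div_nonneg (by linarith) hα.1.le
  refine ⟨le_mul_csInf hk ⟨_, μ.prod ν, isCoupling_prod, isCausalCoupling_prod, rfl⟩ ?_,
    le_mul_csInf hk ⟨_, μ.prod ν, isCoupling_prod, isBicausalCoupling_prod, rfl⟩ ?_⟩
  · rintro _ ⟨π, hc, hπ, rfl⟩
    exact RiskValB_sub_le_of_coupling hB hα hμ hν hc hπ
  · rintro _ ⟨π, hc, hπ, rfl⟩
    refine abs_sub_le_iff.2 ⟨RiskValB_sub_le_of_coupling hB hα hμ hν hc hπ.1, ?_⟩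
    rw [← integral_pathNorm_swap]
    exact RiskValB_sub_le_of_coupling hB hα hν hμ hc.swap hπ.2

end
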